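/- Let $U \subseteq \mathbb{R}^d$ be open and bounded, $V$ open with $\overline{V} \subseteq U$, and let $u$ be a smooth $r$-form on $U$ with $u \in L^2$, $du \in L^2$, $\delta u \in L^2$. Then there is a constant $C = C(d) < \infty$ such that $\|\nabla u\|_{L^2(V)} \le C\big(\|du\|_{L^2(U)} + \|\delta u\|_{L^2(U)} + \operatorname{dist}(V,\partial U)^{-1}\|u\|_{L^2(U)}\big)$. -/

import Mathlib

open MeasureTheory

noncomputable section

/-- The partial derivative `∂_k f` of a function on `ℝ^d`. -/
def pd (d : ℕ) (k : Fin d) (f : (Fin d → ℝ) → ℝ) (x : Fin d → ℝ) : ℝ :=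
  fderiv ℝ f x (Pi.single k 1)

/-- The sign `(-1)^{#{i ∈ I : i < k}}` arising in `dx_k ∧ dx_I`. -/
def dsgn (d : ℕ) (k : Fin d) (I : Finset (Fin d)) : ℝ :=
  (-1 : ℝ) ^ (I.filter (fun i => i < k)).card

/-- The exterior derivative in components. -/
def extd (d : ℕ) (u : Finset (Fin d) → (Fin d → ℝ) → ℝ)
    (J : Finset (Fin d)) (x : Fin d → ℝ) : ℝ :=
  ∑ k ∈ J, dsgn d k J * pd d k (u (J.erase k)) x

/-- The codifferential in components. -/
def codiff (d : ℕ) (u : Finset (Fin d) → (Fin d → ℝ) → ℝ)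
    (I : Finset (Fin d)) (x : Fin d → ℝ) : ℝ :=
  -∑ k ∈ Iᶜ, dsgn d k (insert k I) * pd d k (u (insert k I)) x

/-- The distance between two sets. -/
def setDist {α : Type*} [PseudoMetricSpace α] (A B : Set α) : ℝ :=
  sInf (Set.image2 dist A B)

open scoped ContDiff Convolution in
theorem exists_contDiff_cutoff {E : Type*} [NormedAddCommGroup E] [NormedSpace ℝ E]
    [FiniteDimensional ℝ E] (V : Set E) {δ : ℝ} (hδ : 0 < δ) :
    ∃ η : E → ℝ, ContDiff ℝ ∞ η ∧ (∀ x, ‖fderiv ℝ η x‖ ≤ 3 / δ) ∧ (∀ x, |η x| ≤ 1) ∧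
      (∀ x ∈ V, η x = 1) ∧ ∀ x ∈ tsupport η, Metric.infDist x V < δ := by
  borelize E
  let μ : Measure E := Measure.addHaar
  let g : E → ℝ := fun x => max 0 (min 1 (2 - 3 / δ * Metric.infDist x V))
  have hg0 : ∀ x, 0 ≤ g x := fun x => le_max_left _ _
  have hg1 : ∀ x, g x ≤ 1 := fun x => max_le zero_le_one (min_le_left _ _)
  have hL0 : (0 : ℝ) ≤ 3 / δ := by positivity
  have hglip : ∀ x y, |g x - g y| ≤ 3 / δ * dist x y := by
    intro x y
    have h1 : |Metric.infDist x V - Metric.infDist y V| ≤ dist x y := by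
      simpa [Real.dist_eq] using (Metric.lipschitz_infDist_pt V).dist_le_mul x y
    calc |g x - g y|
        ≤ |min 1 (2 - 3 / δ * Metric.infDist x V) - min 1 (2 - 3 / δ * Metric.infDist y V)| := by
          simpa [g, max_comm] using abs_max_sub_max_le_abs
            (min 1 (2 - 3 / δ * Metric.infDist x V)) (min 1 (2 - 3 / δ * Metric.infDist y V)) 0
      _ ≤ |(2 - 3 / δ * Metric.infDist x V) - (2 - 3 / δ * Metric.infDist y V)| := by
          simpa using abs_min_sub_min_le_max
            1 (2 - 3 / δ * Metric.infDist x V) 1 (2 - 3 / δ * Metric.infDist y V)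
      _ = 3 / δ * |Metric.infDist x V - Metric.infDist y V| := by
          rw [← abs_of_nonneg hL0, ← abs_mul, abs_of_nonneg hL0, ← abs_neg]
          congr 1
          ring
      _ ≤ _ := by gcongr
  have hgc : Continuous g := by
    have := Metric.continuous_infDist_pt V
    fun_prop
  let φ : ContDiffBump (0 : E) := ⟨δ / 8, δ / 4, by positivity, by linarith⟩
  let ψ : E → ℝ := φ.normed μ
  have hψ0 : ∀ t, 0 ≤ ψ t := φ.nonneg_normed
  have hψi : Integrable ψ μ := φ.integrable_normed
  have hψ1 : ∫ t, ψ t ∂μ = 1 := φ.integral_normed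
  let η : E → ℝ := ψ ⋆[ContinuousLinearMap.lsmul ℝ ℝ, μ] g
  have hη : ∀ x, η x = ∫ t, ψ t * g (x - t) ∂μ := fun x => rfl
  have hint : ∀ x, Integrable (fun t => ψ t * g (x - t)) μ := by
    intro x
    refine hψi.mono' (by
      exact (φ.continuous_normed.mul (by fun_prop)).aestronglyMeasurable) (.of_forall fun t => ?_)
    rw [Real.norm_eq_abs, abs_mul, abs_of_nonneg (hψ0 t), abs_of_nonneg (hg0 _)]
    exact mul_le_of_le_one_right (hψ0 t) (hg1 _)
  have hηlip : LipschitzWith ⟨3 / δ, hL0⟩ η := by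
    refine LipschitzWith.of_dist_le_mul fun x y => ?_
    rw [Real.dist_eq, hη, hη, ← integral_sub (hint x) (hint y), ← Real.norm_eq_abs]
    calc _ ≤ ∫ t, ψ t * (3 / δ * dist x y) ∂μ := by
          refine norm_integral_le_of_norm_le (hψi.mul_const _) (.of_forall fun t => ?_)
          rw [← mul_sub, Real.norm_eq_abs, abs_mul, abs_of_nonneg (hψ0 t)]
          have := hglip (x - t) (y - t)
          rw [dist_sub_right] at this
          exact mul_le_mul_of_nonneg_left this (hψ0 t)
      _ = _ := by rw [integral_mul_const, hψ1, one_mul]; rfl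
  refine ⟨η, ?_, fun x => norm_fderiv_le_of_lipschitz ℝ hηlip, fun x => ?_, fun x hx => ?_, ?_⟩
  · exact φ.hasCompactSupport_normed.contDiff_convolution_left _ φ.contDiff_normed
      hgc.locallyIntegrable
  · rw [hη, ← Real.norm_eq_abs]
    calc _ ≤ ∫ t, ψ t ∂μ := by
          refine norm_integral_le_of_norm_le hψi (.of_forall fun t => ?_)
          rw [Real.norm_eq_abs, abs_mul, abs_of_nonneg (hψ0 t), abs_of_nonneg (hg0 _)]
          exact mul_le_of_le_one_right (hψ0 t) (hg1 _)
      _ = 1 := hψ1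
  · have key : ∀ y ∈ Metric.ball x (δ / 4), g y = 1 := by
      intro y hy
      have h1 : Metric.infDist y V ≤ dist y x := Metric.infDist_le_dist_of_mem hx
      have h2 : 3 / δ * Metric.infDist y V ≤ 1 := by
        rw [Metric.mem_ball] at hy
        rw [div_mul_eq_mul_div, div_le_one hδ]
        linarith
      simp only [g]
      rw [min_eq_left (by linarith), max_eq_right zero_le_one]
    have hx1 := key x (Metric.mem_ball_self (by positivity))
    have : η x = g x := φ.normed_convolution_eq_right fun y hy => by rw [key y hy, hx1]
    rw [this, hx1]
  · have hs : Function.support η ⊆ {x | Metric.infDist x V ≤ 11 / 12 * δ} := by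
      intro x hx
      by_contra hlt
      rw [Set.mem_ofPred_eq, not_le] at hlt
      refine hx ?_
      rw [hη]
      refine integral_eq_zero_of_ae (.of_forall fun t => ?_)
      by_cases ht : ψ t = 0
      · simp [ht]
      · have ht' : t ∈ Metric.ball (0 : E) (δ / 4) := by
          have : t ∈ Function.support (φ.normed μ) := ht
          rwa [φ.support_normed_eq] at this
        have h1 : Metric.infDist x V ≤ Metric.infDist (x - t) V + dist x (x - t) :=
          Metric.infDist_le_infDist_add_dist
        rw [mem_ball_zero_iff] at ht'
        rw [dist_self_sub_right] at h1
        have h2 : 2 ≤ 3 / δ * Metric.infDist (x - t) V := by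
          rw [div_mul_eq_mul_div, le_div_iff₀ hδ]
          linarith
        have : g (x - t) = 0 := max_eq_left ((min_le_right _ _).trans (by linarith))
        simp [this]
    intro x hx
    have := closure_minimal hs (isClosed_le (Metric.continuous_infDist_pt V) continuous_const) hx
    rw [Set.mem_ofPred_eq] at this
    linarith

theorem dsgn_mul_self (d : ℕ) (k : Fin d) (I : Finset (Fin d)) : dsgn d k I * dsgn d k I = 1 := by
  rw [dsgn, ← mul_pow]
  norm_num

theorem dsgn_insert {d : ℕ} {k l : Fin d} {I : Finset (Fin d)} (hl : l ∉ I) :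
    dsgn d k (insert l I) = (if l < k then -1 else 1) * dsgn d k I := by
  unfold dsgn
  rw [Finset.filter_insert]
  split_ifs
  · rw [Finset.card_insert_of_notMem (by simp [hl]), pow_succ]
    ring
  · rw [one_mul]

theorem dsgn_mul_dsgn_insert {d : ℕ} {k l : Fin d} {I : Finset (Fin d)} (hkl : k ≠ l)
    (hk : k ∉ I) (hl : l ∉ I) :
    dsgn d k (insert l (insert k I)) * dsgn d l (insert l (insert k I)) =
      -(dsgn d k (insert k I) * dsgn d l (insert l I)) := by
  rw [dsgn_insert (k := k) (l := l) (by simp [hkl.symm, hl]), Finset.insert_comm,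
    dsgn_insert (k := l) (l := k) (by simp [hkl, hk])]
  rcases lt_or_gt_of_ne hkl with h | h
  · simp [h, h.not_gt]
  · simp [h, h.not_gt]

theorem sum_dsgn_erase_add_sum_dsgn_insert {d : ℕ}
    (A : Fin d → Finset (Fin d) → Fin d → Finset (Fin d) → ℝ)
    (hA : ∀ k I l J, A k I l J = A l I k J) (hA' : ∀ k I l J, A k I l J = A l J k I) :
    ∑ J : Finset (Fin d), ∑ k ∈ J, ∑ l ∈ J,
        dsgn d k J * dsgn d l J * A k (J.erase k) l (J.erase l) +
      ∑ I : Finset (Fin d), ∑ k ∈ Iᶜ, ∑ l ∈ Iᶜ,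
        dsgn d k (insert k I) * dsgn d l (insert l I) * A k (insert k I) l (insert l I) =
      ∑ I : Finset (Fin d), ∑ k, A k I k I := by
  have e1 : ∀ (p : Finset (Fin d) → Finset (Fin d)) (f : Finset (Fin d) → Fin d → Fin d → ℝ),
      ∑ J : Finset (Fin d), ∑ k ∈ p J, ∑ l ∈ p J, f J k l =
        ∑ k, ∑ l, ∑ J with k ∈ p J ∧ l ∈ p J, f J k l := by
    intro p f
    have h : ∀ J, ∑ k ∈ p J, ∑ l ∈ p J, f J k l =
        ∑ k, ∑ l, if k ∈ p J ∧ l ∈ p J then f J k l else 0 := by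
      intro J
      simp [ite_and]
    simp only [h, Finset.sum_filter]
    rw [Finset.sum_comm]
    exact Finset.sum_congr rfl fun k _ => Finset.sum_comm
  have e2 : ∑ I : Finset (Fin d), ∑ k, A k I k I =
      ∑ k, ∑ l, if k = l then ∑ I : Finset (Fin d), A k I k I else 0 := by
    rw [Finset.sum_comm]
    simp
  rw [e1 (fun J => J), e1 (fun J => Jᶜ), e2, ← Finset.sum_add_distrib]
  refine Finset.sum_congr rfl fun k _ => ?_
  rw [← Finset.sum_add_distrib]
  refine Finset.sum_congr rfl fun l _ => ?_
  simp only [Finset.mem_compl]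
  split_ifs with hkl
  · subst hkl
    simp only [dsgn_mul_self, one_mul, and_self]
    rw [← Finset.sum_filter_add_sum_filter_not Finset.univ (fun I => k ∈ I)
      (fun I => A k I k I), add_comm]
    congr 1
    · exact Finset.sum_bij' (fun I _ => insert k I) (fun J _ => J.erase k)
        (by simp) (by simp) (by simp +contextual) (by simp +contextual) (by simp)
    · exact Finset.sum_bij' (fun J _ => J.erase k) (fun I _ => insert k I)
        (by simp) (by simp) (by simp +contextual) (by simp +contextual) (by simp)
  · have hlk : l ≠ k := Ne.symm hkl
    rw [← eq_neg_iff_add_eq_zero, ← Finset.sum_neg_distrib]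
    refine Finset.sum_bij' (fun J _ => (J.erase l).erase k) (fun I _ => insert l (insert k I))
      (by simp) (by simp) ?_ ?_ ?_
    · intro J hJ
      simp only [Finset.mem_filter, Finset.mem_univ, true_and] at hJ
      rw [Finset.insert_erase (by simp [hJ.1, hkl]), Finset.insert_erase hJ.2]
    · intro I hI
      simp only [Finset.mem_filter, Finset.mem_univ, true_and] at hI
      rw [Finset.erase_insert (by simp [hI.2, hlk]), Finset.erase_insert hI.1]
    · intro J hJ
      simp only [Finset.mem_filter, Finset.mem_univ, true_and] at hJ
      obtain ⟨K, hk, hl, rfl⟩ : ∃ K, k ∉ K ∧ l ∉ K ∧ insert l (insert k K) = J :=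
        ⟨(J.erase l).erase k, by simp, by simp, by
          rw [Finset.insert_erase (by simp [hJ.1, hkl]), Finset.insert_erase hJ.2]⟩
      have hl' : l ∉ insert k K := by simp [hl, hlk]
      have hk' : k ∉ insert l K := by simp [hk, hkl]
      rw [dsgn_mul_dsgn_insert hkl hk hl, Finset.erase_insert hl', Finset.erase_insert hk,
        Finset.insert_comm, Finset.erase_insert hk', hA k (insert l K),
        hA' l (insert l K)]
      ring

open scoped ContDiff in
theorem ContDiff.pd {d : ℕ} {f : (Fin d → ℝ) → ℝ} (hf : ContDiff ℝ ∞ f) (k : Fin d) :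
    ContDiff ℝ ∞ (pd d k f) :=
  (hf.fderiv_right (m := ∞) (by simp)).clm_apply contDiff_const

theorem HasCompactSupport.pd {d : ℕ} {f : (Fin d → ℝ) → ℝ} (hf : HasCompactSupport f)
    (k : Fin d) : HasCompactSupport (pd d k f) :=
  hf.fderiv_apply (𝕜 := ℝ) (Pi.single k 1)

open scoped ContDiff in
theorem pd_comm {d : ℕ} {f : (Fin d → ℝ) → ℝ} (hf : ContDiff ℝ ∞ f) (k l : Fin d)
    (x : Fin d → ℝ) : pd d k (pd d l f) x = pd d l (pd d k f) x := by
  have hd : DifferentiableAt ℝ (fderiv ℝ f) x :=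
    (hf.fderiv_right (m := ∞) (by simp)).differentiable (by simp) x
  have h : ∀ i j : Fin d, pd d i (pd d j f) x =
      fderiv ℝ (fderiv ℝ f) x (Pi.single i 1) (Pi.single j 1) := by
    intro i j
    change fderiv ℝ (fun y => fderiv ℝ f y (Pi.single j 1)) x (Pi.single i 1) = _
    rw [fderiv_clm_apply hd (differentiableAt_const _)]
    simp
  rw [h, h]
  have h2 : ContDiff ℝ 2 f := by exact_mod_cast contDiff_infty.1 hf 2
  exact (h2.contDiffAt.isSymmSndFDerivAt (by simp)).eq _ _

open scoped ContDiff in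
theorem integral_pd_mul_pd_swap {d : ℕ} {f g : (Fin d → ℝ) → ℝ} (hf : ContDiff ℝ ∞ f)
    (hg : ContDiff ℝ ∞ g) (hfs : HasCompactSupport f) (k l : Fin d) :
    ∫ x, pd d k f x * pd d l g x = ∫ x, pd d l f x * pd d k g x := by
  have key : ∀ i j : Fin d,
      ∫ x, pd d i f x * pd d j g x = -∫ x, pd d j (pd d i f) x * g x := fun i j =>
    integral_mul_fderiv_eq_neg_fderiv_mul_of_integrable
      (((hf.pd i).pd j |>.continuous.mul hg.continuous).integrable_of_hasCompactSupport
        ((hfs.pd i).pd j).mul_right)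
      (((hf.pd i).continuous.mul (hg.pd j).continuous).integrable_of_hasCompactSupport
        (hfs.pd i).mul_right)
      (((hf.pd i).continuous.mul hg.continuous).integrable_of_hasCompactSupport
        (hfs.pd i).mul_right)
      (fun x _ => (hf.pd i).differentiable (by simp) x)
      (fun x _ => hg.differentiable (by simp) x)
  rw [key, key]
  simp_rw [pd_comm hf k l]

open scoped ContDiff in
theorem sum_integral_pd_sq_eq {d : ℕ} {v : Finset (Fin d) → (Fin d → ℝ) → ℝ}
    (hv : ∀ I, ContDiff ℝ ∞ (v I)) (hvs : ∀ I, HasCompactSupport (v I)) :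
    ∑ I : Finset (Fin d), ∑ k : Fin d, ∫ x, (pd d k (v I) x) ^ 2 =
      (∑ I : Finset (Fin d), ∫ x, (extd d v I x) ^ 2) +
        ∑ I : Finset (Fin d), ∫ x, (codiff d v I x) ^ 2 := by
  have hint : ∀ k I l J, Integrable fun x => pd d k (v I) x * pd d l (v J) x := fun k I l J =>
    (((hv I).pd k).continuous.mul ((hv J).pd l).continuous).integrable_of_hasCompactSupport
      ((hvs I).pd k).mul_right
  have expand : ∀ (s : Finset (Fin d)) (c : Fin d → ℝ) (φ : Fin d → Finset (Fin d)),
      ∫ x, (∑ k ∈ s, c k * pd d k (v (φ k)) x) ^ 2 =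
        ∑ k ∈ s, ∑ l ∈ s, c k * c l * ∫ x, pd d k (v (φ k)) x * pd d l (v (φ l)) x := by
    intro s c φ
    have h : ∀ x, (∑ k ∈ s, c k * pd d k (v (φ k)) x) ^ 2 =
        ∑ k ∈ s, ∑ l ∈ s, c k * c l * (pd d k (v (φ k)) x * pd d l (v (φ l)) x) := by
      intro x
      rw [sq, Finset.sum_mul_sum]
      exact Finset.sum_congr rfl fun k _ => Finset.sum_congr rfl fun l _ => by ring
    simp_rw [h]
    rw [integral_finsetSum _ fun k _ => integrable_finsetSum _ fun l _ =>
      (hint _ _ _ _).const_mul _]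
    refine Finset.sum_congr rfl fun k _ => ?_
    rw [integral_finsetSum _ fun l _ => (hint _ _ _ _).const_mul _]
    exact Finset.sum_congr rfl fun l _ => integral_const_mul _ _
  have := sum_dsgn_erase_add_sum_dsgn_insert
    (fun k I l J => ∫ x, pd d k (v I) x * pd d l (v J) x)
    (fun k I l J => integral_pd_mul_pd_swap (hv I) (hv J) (hvs I) k l)
    (fun k I l J => by simp_rw [mul_comm])
  simp only [extd, codiff, neg_sq, expand]
  rw [this]
  simp_rw [sq]

theorem pd_mul {d : ℕ} {f g : (Fin d → ℝ) → ℝ} {x : Fin d → ℝ} (hf : DifferentiableAt ℝ f x)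
    (hg : DifferentiableAt ℝ g x) (k : Fin d) :
    pd d k (fun y => f y * g y) x = f x * pd d k g x + pd d k f x * g x := by
  simp only [pd]
  rw [fderiv_fun_mul hf hg]
  simp [mul_comm]

theorem abs_pd_le {d : ℕ} (f : (Fin d → ℝ) → ℝ) (x : Fin d → ℝ) (k : Fin d) :
    |pd d k f x| ≤ ‖fderiv ℝ f x‖ := by
  simpa [pd, Pi.norm_single] using (fderiv ℝ f x).le_opNorm (Pi.single k 1)

theorem sq_sum_pd_mul_le {d : ℕ} {η : (Fin d → ℝ) → ℝ} {u : Finset (Fin d) → (Fin d → ℝ) → ℝ}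
    {x : Fin d → ℝ} {L : ℝ} (hη : DifferentiableAt ℝ η x) (hu : ∀ I, DifferentiableAt ℝ (u I) x)
    (hη1 : |η x| ≤ 1) (hL : ‖fderiv ℝ η x‖ ≤ L) (s : Finset (Fin d)) {c : Fin d → ℝ}
    (hc : ∀ k, c k * c k = 1) (φ : Fin d → Finset (Fin d)) :
    (∑ k ∈ s, c k * pd d k (fun y => η y * u (φ k) y) x) ^ 2 ≤
      2 * (∑ k ∈ s, c k * pd d k (u (φ k)) x) ^ 2 +
        2 * (d * L) ^ 2 * ∑ I : Finset (Fin d), (u I x) ^ 2 := by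
  set S := ∑ I : Finset (Fin d), (u I x) ^ 2
  set A := ∑ k ∈ s, c k * pd d k (u (φ k)) x
  set B := ∑ k ∈ s, c k * (pd d k η x * u (φ k) x) with hB
  have hS : 0 ≤ S := Finset.sum_nonneg fun I _ => sq_nonneg _
  have hsplit : ∑ k ∈ s, c k * pd d k (fun y => η y * u (φ k) y) x = η x * A + B := by
    rw [Finset.mul_sum, ← Finset.sum_add_distrib]
    refine Finset.sum_congr rfl fun k _ => ?_
    rw [pd_mul hη (hu _)]
    ring
  have hterm : ∀ k, (c k * (pd d k η x * u (φ k) x)) ^ 2 ≤ L ^ 2 * S := by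
    intro k
    have h1 : (pd d k η x) ^ 2 ≤ L ^ 2 :=
      sq_le_sq' (neg_le_of_abs_le ((abs_pd_le η x k).trans hL))
        (le_of_abs_le ((abs_pd_le η x k).trans hL))
    have h2 : (u (φ k) x) ^ 2 ≤ S :=
      Finset.single_le_sum (f := fun I => (u I x) ^ 2) (fun I _ => sq_nonneg _)
        (Finset.mem_univ (φ k))
    calc (c k * (pd d k η x * u (φ k) x)) ^ 2
        = (c k * c k) * ((pd d k η x) ^ 2 * (u (φ k) x) ^ 2) := by ring
      _ = (pd d k η x) ^ 2 * (u (φ k) x) ^ 2 := by rw [hc, one_mul]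
      _ ≤ _ := by gcongr
  have hcard : (s.card : ℝ) ≤ d := by
    exact_mod_cast (Finset.card_le_univ s).trans_eq (Fintype.card_fin d)
  have hB2 : B ^ 2 ≤ (d * L) ^ 2 * S :=
    calc B ^ 2 ≤ s.card * ∑ k ∈ s, (c k * (pd d k η x * u (φ k) x)) ^ 2 :=
          sq_sum_le_card_mul_sum_sq
      _ ≤ s.card * (s.card * (L ^ 2 * S)) := by
          gcongr
          simpa using Finset.sum_le_card_nsmul s _ _ fun k _ => hterm k
      _ ≤ d * (d * (L ^ 2 * S)) := by gcongr
      _ = _ := by ring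
  have hA2 : (η x * A) ^ 2 ≤ A ^ 2 := by
    rw [mul_pow]
    exact mul_le_of_le_one_left (sq_nonneg A) ((sq_le_one_iff_abs_le_one _).2 hη1)
  rw [hsplit]
  linarith [sq_nonneg (η x * A - B)]

theorem cutoff_mul_eventuallyEq_zero {X : Type*} [TopologicalSpace X] {η f : X → ℝ} {x : X}
    (hx : x ∉ tsupport η) : (fun y => η y * f y) =ᶠ[nhds x] fun _ => 0 := by
  filter_upwards [notMem_tsupport_iff_eventuallyEq.1 hx] with y hy
  simp [hy]

theorem pd_cutoff_mul_eq_zero {d : ℕ} {η f : (Fin d → ℝ) → ℝ} {x : Fin d → ℝ}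
    (hx : x ∉ tsupport η) (k : Fin d) : pd d k (fun y => η y * f y) x = 0 := by
  simp [pd, (cutoff_mul_eventuallyEq_zero hx).fderiv_eq]

open scoped ContDiff in
theorem contDiff_cutoff_mul {d : ℕ} {U : Set (Fin d → ℝ)} (hU : IsOpen U)
    {η f : (Fin d → ℝ) → ℝ} (hη : ContDiff ℝ ∞ η) (hηU : tsupport η ⊆ U)
    (hf : ContDiffOn ℝ ∞ f U) : ContDiff ℝ ∞ fun y => η y * f y := by
  refine contDiff_iff_contDiffAt.2 fun x => ?_
  by_cases hx : x ∈ tsupport η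
  · exact hη.contDiffAt.mul (hf.contDiffAt (hU.mem_nhds (hηU hx)))
  · exact contDiffAt_const.congr_of_eventuallyEq (cutoff_mul_eventuallyEq_zero hx)

open scoped ContDiff in
theorem integral_sq_sum_pd_mul_le {d : ℕ} {U : Set (Fin d → ℝ)} (hU : IsOpen U)
    {η : (Fin d → ℝ) → ℝ} {u : Finset (Fin d) → (Fin d → ℝ) → ℝ} {L : ℝ}
    (hη : ContDiff ℝ ∞ η) (hηs : HasCompactSupport η) (hηU : tsupport η ⊆ U)
    (hη1 : ∀ x, |η x| ≤ 1) (hL : ∀ x, ‖fderiv ℝ η x‖ ≤ L)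
    (hu : ∀ I, ContDiffOn ℝ ∞ (u I) U) (hu2 : ∀ I, IntegrableOn (fun x => (u I x) ^ 2) U)
    (s : Finset (Fin d)) {c : Fin d → ℝ} (hc : ∀ k, c k * c k = 1)
    (φ : Fin d → Finset (Fin d))
    (hi : IntegrableOn (fun x => (∑ k ∈ s, c k * pd d k (u (φ k)) x) ^ 2) U) :
    ∫ x, (∑ k ∈ s, c k * pd d k (fun y => η y * u (φ k) y) x) ^ 2 ≤
      2 * (∫ x in U, (∑ k ∈ s, c k * pd d k (u (φ k)) x) ^ 2) +
        2 * (d * L) ^ 2 * ∑ I : Finset (Fin d), ∫ x in U, (u I x) ^ 2 := by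
  have hv : ∀ I, ContDiff ℝ ∞ fun y => η y * u I y := fun I =>
    contDiff_cutoff_mul hU hη hηU (hu I)
  have hvi : Integrable fun x => (∑ k ∈ s, c k * pd d k (fun y => η y * u (φ k) y) x) ^ 2 := by
    refine Continuous.integrable_of_hasCompactSupport ?_ (hηs.mono' fun x hx => ?_)
    · exact (continuous_finsetSum _ fun k _ =>
        continuous_const.mul ((hv (φ k)).pd k).continuous).pow 2
    · by_contra h
      simp [pd_cutoff_mul_eq_zero h] at hx
  have hS : IntegrableOn (fun x => ∑ I : Finset (Fin d), (u I x) ^ 2) U :=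
    integrable_finsetSum _ fun I _ => hu2 I
  rw [← setIntegral_eq_integral_of_forall_compl_eq_zero (s := U) fun x hx => by
    simp [pd_cutoff_mul_eq_zero fun h => hx (hηU h)]]
  calc _ ≤ ∫ x in U, (2 * (∑ k ∈ s, c k * pd d k (u (φ k)) x) ^ 2 +
          2 * (d * L) ^ 2 * ∑ I : Finset (Fin d), (u I x) ^ 2) := by
        refine setIntegral_mono_on hvi.integrableOn ((hi.const_mul 2).add (hS.const_mul _))
          hU.measurableSet fun x hx => ?_
        exact sq_sum_pd_mul_le (hη.differentiable (by simp) x)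
          (fun I => ((hu I).contDiffAt (hU.mem_nhds hx)).differentiableAt (by simp))
          (hη1 x) (hL x) s hc φ
    _ = _ := by
        rw [integral_add (hi.const_mul 2) (hS.const_mul _), integral_const_mul,
          integral_const_mul, integral_finsetSum _ fun I _ => hu2 I]

theorem setDist_nonneg {α : Type*} [PseudoMetricSpace α] (A B : Set α) : 0 ≤ setDist A B :=
  Real.sInf_nonneg (by rintro _ ⟨a, _, b, _, rfl⟩; exact dist_nonneg)

theorem setDist_le_dist {α : Type*} [PseudoMetricSpace α] {A B : Set α} {a b : α} (ha : a ∈ A)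
    (hb : b ∈ B) : setDist A B ≤ dist a b :=
  csInf_le ⟨0, by rintro _ ⟨a, _, b, _, rfl⟩; exact dist_nonneg⟩ ⟨a, ha, b, hb, rfl⟩

theorem mem_of_infDist_lt_setDist_frontier {E : Type*} [NormedAddCommGroup E] [NormedSpace ℝ E]
    [FiniteDimensional ℝ E] {U V : Set E} (hVU : V ⊆ U) (hU : U ≠ Set.univ) (hV : V.Nonempty)
    {x : E} (hx : Metric.infDist x V < setDist V (frontier U)) : x ∈ U := by
  obtain ⟨y, hy, hxy⟩ := (Metric.infDist_lt_iff hV).1 hx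
  obtain ⟨z, hz, hyz⟩ := exists_mem_frontier_infDist_compl_eq_dist (hVU hy) hU
  by_contra hxU
  have h1 : Metric.infDist y Uᶜ ≤ dist y x := Metric.infDist_le_dist_of_mem hxU
  have h2 := setDist_le_dist hy hz
  rw [dist_comm] at hxy
  linarith

theorem setDist_frontier_pos {E : Type*} [NormedAddCommGroup E] [NormedSpace ℝ E]
    [FiniteDimensional ℝ E] {U V : Set E} (hUo : IsOpen U) (hUb : Bornology.IsBounded U)
    (hVU : closure V ⊆ U) (hU : U ≠ Set.univ) (hV : V.Nonempty) :
    0 < setDist V (frontier U) := by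
  have hK : IsCompact (closure V) :=
    Metric.isCompact_of_isClosed_isBounded isClosed_closure (hUb.subset hVU)
  obtain ⟨r, hr, hrU⟩ := hK.exists_thickening_subset_open hUo hVU
  obtain ⟨y, hy⟩ := hV
  obtain ⟨z, hz, -⟩ := exists_mem_frontier_infDist_compl_eq_dist (hVU (subset_closure hy)) hU
  refine hr.trans_le (le_csInf ⟨_, y, hy, z, hz, rfl⟩ ?_)
  rintro _ ⟨a, ha, b, hb, rfl⟩
  by_contra! h
  have hbU : b ∈ U :=
    hrU (Metric.mem_thickening_iff.2 ⟨a, subset_closure ha, by rwa [dist_comm]⟩)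
  exact (hUo.frontier_eq ▸ hb).2 hbU

open scoped ContDiff in
theorem sum_setIntegral_pd_sq_le {d : ℕ} {U V : Set (Fin d → ℝ)} (hU : IsOpen U)
    (hV : IsOpen V) {η : (Fin d → ℝ) → ℝ} {u : Finset (Fin d) → (Fin d → ℝ) → ℝ} {L : ℝ}
    (hη : ContDiff ℝ ∞ η) (hηs : HasCompactSupport η) (hηU : tsupport η ⊆ U)
    (hη1 : ∀ x, |η x| ≤ 1) (hηV : ∀ x ∈ V, η x = 1) (hL : ∀ x, ‖fderiv ℝ η x‖ ≤ L)
    (hu : ∀ I, ContDiffOn ℝ ∞ (u I) U) (hu2 : ∀ I, IntegrableOn (fun x => (u I x) ^ 2) U)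
    (hdu : ∀ I, IntegrableOn (fun x => (extd d u I x) ^ 2) U)
    (hδu : ∀ I, IntegrableOn (fun x => (codiff d u I x) ^ 2) U) :
    ∑ I : Finset (Fin d), ∑ k : Fin d, ∫ x in V, (pd d k (u I) x) ^ 2 ≤
      2 * (∑ I : Finset (Fin d), ∫ x in U, (extd d u I x) ^ 2) +
        2 * (∑ I : Finset (Fin d), ∫ x in U, (codiff d u I x) ^ 2) +
        4 * 2 ^ d * (d * L) ^ 2 * ∑ I : Finset (Fin d), ∫ x in U, (u I x) ^ 2 := by
  let v : Finset (Fin d) → (Fin d → ℝ) → ℝ := fun I y => η y * u I y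
  have hv : ∀ I, ContDiff ℝ ∞ (v I) := fun I => contDiff_cutoff_mul hU hη hηU (hu I)
  have hvs : ∀ I, HasCompactSupport (v I) := fun I => hηs.mul_right
  have h1 : ∀ I k, ∫ x in V, (pd d k (u I) x) ^ 2 ≤ ∫ x, (pd d k (v I) x) ^ 2 := by
    intro I k
    have heq : ∀ x ∈ V, (pd d k (u I) x) ^ 2 = (pd d k (v I) x) ^ 2 := by
      intro x hx
      have : u I =ᶠ[nhds x] v I := by
        filter_upwards [hV.mem_nhds hx] with y hy
        simp [v, hηV y hy]
      simp only [pd, this.fderiv_eq]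
    rw [setIntegral_congr_fun hV.measurableSet heq]
    refine setIntegral_le_integral ?_ (.of_forall fun x => sq_nonneg _)
    simp_rw [sq]
    exact (((hv I).pd k).continuous.mul ((hv I).pd k).continuous).integrable_of_hasCompactSupport
      ((hvs I).pd k).mul_right
  set S := ∑ I : Finset (Fin d), ∫ x in U, (u I x) ^ 2
  have h2 : ∀ J, ∫ x, (extd d v J x) ^ 2 ≤
      2 * (∫ x in U, (extd d u J x) ^ 2) + 2 * (d * L) ^ 2 * S := fun J =>
    integral_sq_sum_pd_mul_le hU hη hηs hηU hη1 hL hu hu2 J (fun k => dsgn_mul_self d k J)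
      (fun k => J.erase k) (hdu J)
  have h3 : ∀ I, ∫ x, (codiff d v I x) ^ 2 ≤
      2 * (∫ x in U, (codiff d u I x) ^ 2) + 2 * (d * L) ^ 2 * S := by
    intro I
    have := hδu I
    simp only [codiff, neg_sq] at this ⊢
    exact integral_sq_sum_pd_mul_le hU hη hηs hηU hη1 hL hu hu2 Iᶜ
      (fun k => dsgn_mul_self d k (insert k I)) (fun k => insert k I) this
  calc _ ≤ ∑ I : Finset (Fin d), ∑ k : Fin d, ∫ x, (pd d k (v I) x) ^ 2 :=
        Finset.sum_le_sum fun I _ => Finset.sum_le_sum fun k _ => h1 I k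
    _ = _ := sum_integral_pd_sq_eq hv hvs
    _ ≤ _ := add_le_add (Finset.sum_le_sum fun J _ => h2 J) (Finset.sum_le_sum fun I _ => h3 I)
    _ = _ := by
        simp only [Finset.sum_add_distrib, ← Finset.mul_sum, Finset.sum_const, Finset.card_univ,
          Fintype.card_finset, Fintype.card_fin, nsmul_eq_mul]
        push_cast
        ring

/-- Interior Gaffney–Friedrichs inequality: there is `C = C(d)` such that for every
bounded open `U`, open `V` with `closure V ⊆ U`, and every smooth `r`-form `u` on `U`
with `u, du, δu ∈ L²(U)`,
`‖∇u‖_{L²(V)} ≤ C(‖du‖_{L²(U)} + ‖δu‖_{L²(U)} + dist(V,∂U)⁻¹ ‖u‖_{L²(U)})`. -/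
theorem stmt7 (d : ℕ) :
    ∃ C : ℝ, 0 < C ∧
      ∀ (U V : Set (Fin d → ℝ)), IsOpen U → Bornology.IsBounded U → IsOpen V →
        closure V ⊆ U →
        ∀ (r : ℕ) (u : Finset (Fin d) → (Fin d → ℝ) → ℝ),
          (∀ I : Finset (Fin d), I.card ≠ r → u I = 0) →
          (∀ I, ContDiffOn ℝ (⊤ : ℕ∞) (u I) U) →
          (∀ I, IntegrableOn (fun x => (u I x) ^ 2) U) →
          (∀ I, IntegrableOn (fun x => (extd d u I x) ^ 2) U) →
          (∀ I, IntegrableOn (fun x => (codiff d u I x) ^ 2) U) →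
          Real.sqrt (∑ I : Finset (Fin d), ∑ k : Fin d, ∫ x in V, (pd d k (u I) x) ^ 2) ≤
            C * (Real.sqrt (∑ I : Finset (Fin d), ∫ x in U, (extd d u I x) ^ 2)
              + Real.sqrt (∑ I : Finset (Fin d), ∫ x in U, (codiff d u I x) ^ 2)
              + (setDist V (frontier U))⁻¹ *
                  Real.sqrt (∑ I : Finset (Fin d), ∫ x in U, (u I x) ^ 2)) := by
  refine ⟨6 * (d + 1) * 2 ^ d, by positivity, ?_⟩
  intro U V hU hUb hV hVU r u _ hu hu2 hdu hδu
  set a := ∑ I : Finset (Fin d), ∫ x in U, (extd d u I x) ^ 2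
  set b := ∑ I : Finset (Fin d), ∫ x in U, (codiff d u I x) ^ 2
  set S := ∑ I : Finset (Fin d), ∫ x in U, (u I x) ^ 2
  set δ := setDist V (frontier U)
  have ha : 0 ≤ a := Finset.sum_nonneg fun I _ => integral_nonneg fun x => sq_nonneg _
  have hb : 0 ≤ b := Finset.sum_nonneg fun I _ => integral_nonneg fun x => sq_nonneg _
  have hS : 0 ≤ S := Finset.sum_nonneg fun I _ => integral_nonneg fun x => sq_nonneg _
  have hδ0 : 0 ≤ δ⁻¹ := inv_nonneg.2 (setDist_nonneg _ _)
  rcases Nat.eq_zero_or_pos d with rfl | hd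
  · simp only [Finset.univ_eq_empty, Finset.sum_empty, Finset.sum_const_zero, Real.sqrt_zero]
    positivity
  rcases V.eq_empty_or_nonempty with rfl | hVne
  · simp only [Measure.restrict_empty, integral_zero_measure, Finset.sum_const_zero,
      Real.sqrt_zero]
    positivity
  have : Nonempty (Fin d) := ⟨⟨0, hd⟩⟩
  have hU1 : U ≠ Set.univ := fun h => NormedSpace.unbounded_univ ℝ (Fin d → ℝ) (h ▸ hUb)
  have hδ : 0 < δ := setDist_frontier_pos hU hUb hVU hU1 hVne
  obtain ⟨η, hη, hL, hη1, hηV, hηs⟩ := exists_contDiff_cutoff V hδ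
  have hηU : tsupport η ⊆ U := fun x hx =>
    mem_of_infDist_lt_setDist_frontier (subset_closure.trans hVU) hU1 hVne (hηs x hx)
  have hηc : HasCompactSupport η :=
    Metric.isCompact_of_isClosed_isBounded (isClosed_tsupport η) (hUb.subset hηU)
  have main := sum_setIntegral_pd_sq_le hU hV hη hηc hηU hη1 hηV hL hu hu2 hdu hδu
  refine Real.sqrt_le_iff.2 ⟨by positivity, main.trans ?_⟩
  have hN : (1 : ℝ) ≤ 2 ^ d := one_le_pow₀ one_le_two
  have hN2 : (2 : ℝ) ^ d ≤ (2 ^ d) ^ 2 := le_self_pow₀ hN two_ne_zero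
  have hd1 : (1 : ℝ) ≤ d + 1 := by simp
  have hC : (2 : ℝ) ≤ (6 * (d + 1) * 2 ^ d) ^ 2 := by
    have : (6 : ℝ) ≤ 6 * (d + 1) * 2 ^ d := by
      have := one_le_mul_of_one_le_of_one_le hd1 hN
      linarith
    nlinarith
  have hC' : 36 * 2 ^ d * (d : ℝ) ^ 2 ≤ (6 * (d + 1) * 2 ^ d) ^ 2 := by
    calc 36 * 2 ^ d * (d : ℝ) ^ 2 ≤ 36 * (2 ^ d) ^ 2 * ((d : ℝ) + 1) ^ 2 := by
          gcongr
          linarith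
      _ = _ := by ring
  calc 2 * a + 2 * b + 4 * 2 ^ d * (d * (3 / δ)) ^ 2 * S
      = 2 * √a ^ 2 + 2 * √b ^ 2 + 36 * 2 ^ d * (d : ℝ) ^ 2 * (δ⁻¹ * √S) ^ 2 := by
        rw [mul_pow δ⁻¹, Real.sq_sqrt ha, Real.sq_sqrt hb, Real.sq_sqrt hS]
        ring
    _ ≤ (6 * (d + 1) * 2 ^ d) ^ 2 * √a ^ 2 + (6 * (d + 1) * 2 ^ d) ^ 2 * √b ^ 2 +
          (6 * (d + 1) * 2 ^ d) ^ 2 * (δ⁻¹ * √S) ^ 2 := by gcongr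
    _ = (6 * (d + 1) * 2 ^ d) ^ 2 * (√a ^ 2 + √b ^ 2 + (δ⁻¹ * √S) ^ 2) := by ring
    _ ≤ (6 * (d + 1) * 2 ^ d) ^ 2 * (√a + √b + δ⁻¹ * √S) ^ 2 := by
        gcongr
        have h1 := Real.sqrt_nonneg a
        have h2 := Real.sqrt_nonneg b
        have h3 : 0 ≤ δ⁻¹ * √S := by positivity
        nlinarith [mul_nonneg h1 h2, mul_nonneg h1 h3, mul_nonneg h2 h3]
    _ = _ := by ring

end
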